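/- arXiv:1601.03521 — 2 statements merged into one kernel-verified Lean document; each statement's English description precedes it below -/
import Mathlib

section
/- (Layers flipping property) Let A be a symmetric n×n real matrix that is Robinsonian, let a ∈ V be an anchor of A, and let (L_0 = {a}, L_1, L_2, ...) be the similarity layers of A rooted at a. Let σ be a good SFS ordering of A starting at a and let σ_+ be an SFS_+ ordering of A with respect to σ. If x ∈ L_i and y ∈ L_j with 0 ≤ i < j, then y <_{σ_+} x. -/
/-- `π` is a Robinson ordering of the symmetric matrix `A`: entries are monotone
nondecreasing towards the diagonal. Here `π x` is the position of vertex `x`. -/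
def IsRobinsonOrdering {n : ℕ} (A : Matrix (Fin n) (Fin n) ℝ)
    (π : Equiv.Perm (Fin n)) : Prop :=
  ∀ x y z : Fin n, π x < π y → π y < π z → A x z ≤ min (A x y) (A y z)

/-- `A` is Robinsonian: it admits a Robinson ordering. -/
def IsRobinsonian {n : ℕ} (A : Matrix (Fin n) (Fin n) ℝ) : Prop :=
  ∃ π : Equiv.Perm (Fin n), IsRobinsonOrdering A π

/-- There is a path from `x` to `z` avoiding `y`: a sequence `x = v 0, v 1, ..., v k = z`
with `A (v i) (v (i+1)) > min (A y (v i)) (A y (v (i+1)))` for all `i < k`. -/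
def PathAvoiding {n : ℕ} (A : Matrix (Fin n) (Fin n) ℝ) (x y z : Fin n) : Prop :=
  ∃ (k : ℕ) (v : ℕ → Fin n), v 0 = x ∧ v k = z ∧
    ∀ i < k, min (A y (v i)) (A y (v (i + 1))) < A (v i) (v (i + 1))

/-- `z` is valid: for no pair of distinct vertices `u, v ≠ z` there exist both a path
from `u` to `z` avoiding `v` and a path from `v` to `z` avoiding `u`. -/
def IsValid {n : ℕ} (A : Matrix (Fin n) (Fin n) ℝ) (z : Fin n) : Prop :=
  ∀ u v : Fin n, u ≠ v → u ≠ z → v ≠ z →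
    ¬ (PathAvoiding A u v z ∧ PathAvoiding A v u z)

/-- `a` is the first element of the linear order `π`. -/
def IsFirstOf {n : ℕ} (π : Equiv.Perm (Fin n)) (a : Fin n) : Prop :=
  ∀ y : Fin n, π a ≤ π y

/-- `a` is the last element of the linear order `π`. -/
def IsLastOf {n : ℕ} (π : Equiv.Perm (Fin n)) (a : Fin n) : Prop :=
  ∀ y : Fin n, π y ≤ π a

/-- `a` is an anchor of `A`: some Robinson ordering of `A` ends with `a`. -/
def IsAnchor {n : ℕ} (A : Matrix (Fin n) (Fin n) ℝ) (a : Fin n) : Prop :=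
  ∃ π : Equiv.Perm (Fin n), IsRobinsonOrdering A π ∧ IsLastOf π a

/-- `a, b` are opposite anchors of `A`: some Robinson ordering starts with `a` and
ends with `b`. -/
def OppositeAnchors {n : ℕ} (A : Matrix (Fin n) (Fin n) ℝ) (a b : Fin n) : Prop :=
  ∃ π : Equiv.Perm (Fin n), IsRobinsonOrdering A π ∧ IsFirstOf π a ∧ IsLastOf π b

/-- `σ` is an SFS ordering of `A` (3-point characterization): whenever
`x <_σ y <_σ z` and `A x z > A x y`, some `u <_σ x` has `A u y > A u z`. -/
def IsSFSOrdering {n : ℕ} (A : Matrix (Fin n) (Fin n) ℝ)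
    (σ : Equiv.Perm (Fin n)) : Prop :=
  ∀ x y z : Fin n, σ x < σ y → σ y < σ z → A x y < A x z →
    ∃ u : Fin n, σ u < σ x ∧ A u z < A u y

/-- `σ` is an SFS₊ ordering of `A` with respect to `τ`: it is an SFS ordering and
ties are broken according to `τ` (whenever `y <_σ z` are tied, `z <_τ y`). -/
def IsSFSPlus {n : ℕ} (A : Matrix (Fin n) (Fin n) ℝ)
    (τ σ : Equiv.Perm (Fin n)) : Prop :=
  IsSFSOrdering A σ ∧
    ∀ y z : Fin n, σ y < σ z → (∀ u : Fin n, σ u < σ y → A u y = A u z) → τ z < τ y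

/-- `σ` is a good SFS ordering of `A`: it is an SFS ordering whose first element is
the last element of some SFS ordering of `A`. -/
def IsGoodSFS {n : ℕ} (A : Matrix (Fin n) (Fin n) ℝ)
    (σ : Equiv.Perm (Fin n)) : Prop :=
  IsSFSOrdering A σ ∧
    ∃ b : Fin n, IsFirstOf σ b ∧ ∃ τ : Equiv.Perm (Fin n), IsSFSOrdering A τ ∧ IsLastOf τ b

/-- The union `L_0 ∪ L_1 ∪ ... ∪ L_i` of the similarity layers of `A` rooted at `a`. -/
def simLayerUnion {n : ℕ} (A : Matrix (Fin n) (Fin n) ℝ) (a : Fin n) : ℕ → Set (Fin n)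
  | 0 => {a}
  | i + 1 => simLayerUnion A a i ∪
      {y | y ∉ simLayerUnion A a i ∧
        ∀ x ∈ simLayerUnion A a i, ∀ z ∉ simLayerUnion A a i, A x z ≤ A x y}

/-- The `i`th similarity layer `L_i` of `A` rooted at `a`: `L_0 = {a}` and
`L_{i+1} = {y ∉ L_0 ∪ ... ∪ L_i : A x y ≥ A x z for all x ∈ L_0 ∪ ... ∪ L_i and
z ∉ L_0 ∪ ... ∪ L_i}`. -/
def simLayer {n : ℕ} (A : Matrix (Fin n) (Fin n) ℝ) (a : Fin n) : ℕ → Set (Fin n)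
  | 0 => {a}
  | i + 1 => {y | y ∉ simLayerUnion A a i ∧
      ∀ x ∈ simLayerUnion A a i, ∀ z ∉ simLayerUnion A a i, A x z ≤ A x y}

theorem simLayerUnion_mono_succ {n : ℕ} (A : Matrix (Fin n) (Fin n) ℝ) (a : Fin n) :
    Monotone (simLayerUnion A a) :=
  monotone_nat_of_le_succ (fun i => by
    intro x hx
    exact Or.inl hx)

theorem simLayer_sub_union {n : ℕ} (A : Matrix (Fin n) (Fin n) ℝ) (a : Fin n) (i : ℕ)
    (x : Fin n) (hx : x ∈ simLayer A a i) : x ∈ simLayerUnion A a i := by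
  cases i with
  | zero => exact hx
  | succ i => exact Or.inr hx

/-- An SFS ordering starting at `a` visits the layers in order. -/
theorem sfs_layers {n : ℕ} (A : Matrix (Fin n) (Fin n) ℝ) (a : Fin n)
    (σ : Equiv.Perm (Fin n)) (hσ : IsSFSOrdering A σ) (hσa : IsFirstOf σ a) (i : ℕ) :
    ∀ x ∈ simLayerUnion A a i, ∀ y ∉ simLayerUnion A a i, σ x < σ y := by
  induction i with
  | zero =>
    intro x hx y hy
    have hx : x = a := hx
    have hy : ¬ y = a := hy
    subst hx
    exact lt_of_le_of_ne (hσa y) (fun h => hy (σ.injective h).symm)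
  | succ i ih =>
    intro x hx y hy
    have hy1 : y ∉ simLayerUnion A a i := fun h => hy (Or.inl h)
    rcases hx with hx | hx
    · exact ih x hx y hy1
    · by_contra hlt
      have hyx : σ y < σ x := by
        refine lt_of_le_of_ne (not_lt.mp hlt) (fun h => hy ?_)
        rw [σ.injective h]; exact Or.inr hx
      have hex : ∃ u ∈ simLayerUnion A a i, ∃ z, z ∉ simLayerUnion A a i ∧ A u y < A u z := by
        by_contra hno
        push Not at hno
        exact hy (Or.inr ⟨hy1, fun u hu z hz => hno u hu z hz⟩)
      obtain ⟨u, hu, z, hz, huz⟩ := hex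
      have h1 := hx.2 u hu z hz
      obtain ⟨w, hw, hw2⟩ := hσ u y x (ih u hu y hy1) hyx (lt_of_lt_of_le huz h1)
      have hwU : w ∈ simLayerUnion A a i := by
        by_contra h
        exact absurd (ih u hu w h) (not_lt.mpr hw.le)
      exact absurd (hx.2 w hwU y hy1) (not_le.mpr hw2)

theorem rob_rev_sfs {n : ℕ} (A : Matrix (Fin n) (Fin n) ℝ) (hA : A.IsSymm)
    (π : Equiv.Perm (Fin n)) (hπ : IsRobinsonOrdering A π) :
    IsSFSOrdering A (π.trans Fin.revPerm) := by
  intro x y z h1 h2 h3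
  simp only [Equiv.trans_apply, Fin.revPerm_apply, Fin.rev_lt_rev] at h1 h2
  have h := (le_min_iff.mp (hπ z y x h2 h1)).2
  rw [hA.apply, hA.apply x y] at h
  exact absurd h (not_le.mpr h3)

/-- Layers flipping property: If `σ` is a good SFS ordering of a
symmetric Robinsonian matrix `A` starting at the anchor `a`, `σ₊` is an SFS₊ ordering of
`A` with respect to `σ`, and `x ∈ L_i`, `y ∈ L_j` with `i < j` (similarity layers rooted
at `a`), then `y <_{σ₊} x`. -/
theorem stmt_17 {n : ℕ} (A : Matrix (Fin n) (Fin n) ℝ) (hA : A.IsSymm)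
    (hRob : IsRobinsonian A) (a : Fin n) (ha : IsAnchor A a)
    (σ : Equiv.Perm (Fin n)) (hσ : IsGoodSFS A σ) (hσa : IsFirstOf σ a)
    (σp : Equiv.Perm (Fin n)) (hσp : IsSFSPlus A σ σp)
    (i j : ℕ) (hij : i < j)
    (x : Fin n) (hx : x ∈ simLayer A a i) (y : Fin n) (hy : y ∈ simLayer A a j) :
    σp y < σp x := by
  obtain ⟨π, hπ, hπa⟩ := ha
  have hsfs := rob_rev_sfs A hA π hπ
  have hfirst : IsFirstOf (π.trans Fin.revPerm) a := by
    intro z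
    simpa [Fin.rev_le_rev] using hπa z
  have hπL : ∀ k, ∀ x ∈ simLayerUnion A a k, ∀ y ∉ simLayerUnion A a k, π y < π x := by
    intro k x hx y hy
    have := sfs_layers A a _ hsfs hfirst k x hx y hy
    simpa [Fin.rev_lt_rev] using this
  have hσL := sfs_layers A a σ hσ.1 hσa
  obtain ⟨hp, hties⟩ := hσp
  obtain ⟨m, rfl⟩ : ∃ m, j = m + 1 := ⟨j - 1, by omega⟩
  have hxm : x ∈ simLayerUnion A a m :=
    simLayerUnion_mono_succ A a (by omega : i ≤ m) (simLayer_sub_union A a i x hx)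
  clear hx
  induction hN : (σp x).val using Nat.strong_induction_on generalizing x with
  | _ N ih =>
  by_contra hlt
  have hxy : σp x < σp y :=
    lt_of_le_of_ne (not_lt.mp hlt) (fun h => hy.1 (σp.injective h ▸ hxm))
  -- vertices before `x` in `σp` lie outside the union of the first layers
  have hout : ∀ u, σp u < σp x → u ∉ simLayerUnion A a m := by
    intro u hu huU
    have h := ih (σp u).val (by rw [← hN]; exact hu) u huU rfl
    exact absurd (h.trans hu) (not_lt.mpr hxy.le)
  -- for those, `A u x ≤ A u y`
  have hle : ∀ u, σp u < σp x → A u x ≤ A u y := by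
    intro u hu
    have huU := hout u hu
    have huy : σp u < σp y := hu.trans hxy
    by_cases huL : u ∈ simLayerUnion A a (m + 1)
    · have huL' : u ∈ simLayer A a (m + 1) := huL.resolve_left huU
      have e1 := huL'.2 x hxm y hy.1
      have e2 := hy.2 x hxm u huU
      have hne : π u ≠ π y := fun h => by
        rw [π.injective h] at huy; exact lt_irrefl _ huy
      rcases lt_or_gt_of_ne hne with h | h
      · exact (le_min_iff.mp (hπ u y x h (hπL m x hxm y hy.1))).1
      · have h3 := (le_min_iff.mp (hπ y u x h (hπL m x hxm u huU))).1
        rw [hA.apply x y, hA.apply u y] at h3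
        rw [hA.apply x u]
        exact e2.trans h3
    · have h1 := hπL (m + 1) y (Or.inr hy) u huL
      exact (le_min_iff.mp (hπ u y x h1 (hπL m x hxm y hy.1))).1
  by_cases htie : ∀ u, σp u < σp x → A u x = A u y
  · exact absurd (hties x y hxy htie) (not_lt.mpr (hσL m x hxm y hy.1).le)
  · push Not at htie
    obtain ⟨u, hu, hne⟩ := htie
    obtain ⟨w, hw, hw2⟩ := hp u x y hu hxy (lt_of_le_of_ne (hle u hu) hne)
    exact absurd (hle w (hw.trans hu)) (not_le.mpr hw2)
end

section
/- Let A be a symmetric n×n matrix with entries in {0,1} and zero diagonal, whose support graph (vertex set V, edges the pairs {x,y} with A_{xy} = 1) is connected. Let σ_0 be an SFS ordering of A, let σ_1 be an SFS_+ ordering of A with respect to σ_0, and let σ_2 be an SFS_+ ordering of A with respect to σ_1. Then A is Robinsonian if and only if σ_2 is a Robinson ordering of A. -/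
namespace SFSProof

variable {V : Type} 

def Rob (G : V → V → Prop) (π : V → ℤ) : Prop :=
  ∀ x y z, π x < π y → π y < π z → G x z → G x y ∧ G y z

def LB (G : V → V → Prop) (σ : V → ℤ) : Prop :=
  ∀ x y z, σ x < σ y → σ y < σ z → G x z → ¬ G x y → ∃ u, σ u < σ x ∧ G u y ∧ ¬ G u z

def Par (G : V → V → Prop) (σ : V → ℤ) (s : V) : Prop :=
  ∀ v, v ≠ s → ∃ p, σ p < σ v ∧ G p v

theorem lt_or (π : V → ℤ) (h : Function.Injective π) {x y : V} (hxy : x ≠ y) :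
    π x < π y ∨ π y < π x := lt_or_gt_of_ne (fun e => hxy (h e))

theorem exists_first [Finite V] (σ : V → ℤ) (P : V → Prop) (h : ∃ x, P x) :
    ∃ x, P x ∧ ∀ y, P y → σ x ≤ σ y := by
  obtain ⟨x, hx, hm⟩ := Set.exists_min_image {x | P x} σ (Set.toFinite _) h
  exact ⟨x, hx, hm⟩

theorem Rob.neg {G : V → V → Prop} (hs : ∀ x y, G x y → G y x) {π : V → ℤ} (h : Rob G π) :
    Rob G (fun x => - π x) := by
  intro x y z h1 h2 h3
  have := h z y x (by simpa using h2) (by simpa using h1) (hs _ _ h3)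
  exact ⟨hs _ _ this.2, hs _ _ this.1⟩

theorem lemN [Finite V] {G : V → V → Prop} (hs : ∀ x y, G x y → G y x) {π σ : V → ℤ}
    (hπ : Function.Injective π) (hσ : Function.Injective σ)
    (hR : Rob G π) (hL : LB G σ) {s : V} (hP : Par G σ s) (w u : V)
    (hsw : π s ≤ π w) (hwu : π w < π u) (hG : ¬ G w u) : σ w < σ u := by
  by_contra hcon
  obtain ⟨u, ⟨w, hsw, hwu, hG, hc⟩, hmin⟩ := exists_first σ
    (fun u => ∃ w, π s ≤ π w ∧ π w < π u ∧ ¬ G w u ∧ ¬ σ w < σ u) ⟨u, w, hsw, hwu, hG, hcon⟩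
  have huw : σ u < σ w := by
    rcases lt_or σ hσ (x := u) (y := w) (by rintro rfl; omega) with h | h
    · exact h
    · exact absurd h hc
  have hus : u ≠ s := by rintro rfl; omega
  obtain ⟨p, ⟨hpu, hGp⟩, hpmin⟩ := exists_first σ (fun p => σ p < σ u ∧ G p u) (hP u hus)
  have key : ∀ p, σ p < σ u → π w < π p → G p w := by
    intro p hp hwp
    by_contra hn
    have := hmin p ⟨w, hsw, hwp, fun h => hn (hs _ _ h), by omega⟩
    omega
  have hwp : π w < π p := by
    rcases lt_or π hπ (x := p) (y := w) (by rintro rfl; omega) with h | h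
    · exact absurd (hR p w u h hwu hGp).2 hG
    · exact h
  have hGpw := key p hpu hwp
  have hq : ∀ q, σ q < σ p → ¬ G q w := by
    intro q hqp hqw
    have hqu : ¬ G q u := fun h => by
      have := hpmin q ⟨by omega, h⟩
      omega
    obtain ⟨r, hr, hru, _⟩ := hL q u w (by omega) huw hqw hqu
    have := hpmin r ⟨by omega, hru⟩
    omega
  have hps : p ≠ s := by rintro rfl; omega
  obtain ⟨p', hp', hGp'⟩ := hP p hps
  rcases lt_or π hπ (x := p') (y := w) (by rintro rfl; omega) with h | h
  · exact hq p' hp' (hR p' w p h hwp hGp').1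
  · exact hq p' hp' (key p' (by omega) h)

theorem lemL [Finite V] {G : V → V → Prop} (hs : ∀ x y, G x y → G y x) {π σ : V → ℤ}
    (hπ : Function.Injective π) (hσ : Function.Injective σ)
    (hR : Rob G π) (hL : LB G σ) {s : V} (hP : Par G σ s) (w y z : V)
    (hsw : π s ≤ π w) (hwy : π w < π y) (hyz : π y < π z) (hG : G w y) (hG' : ¬ G w z) :
    σ y < σ z := by
  have hN := lemN hs hπ hσ hR hL hP
  have hwz := hN w z hsw (by omega) hG'
  rcases lt_or σ hσ (x := y) (y := z) (by rintro rfl; omega) with h | h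
  · exact h
  · obtain ⟨u, huw, huz, huy⟩ := hL w z y hwz h hG hG'
    rcases lt_or π hπ (x := u) (y := y) (by rintro rfl; omega) with h2 | h2
    · exact absurd (hR u y z h2 hyz huz).1 huy
    · have : ¬ G w u := fun h3 => huy (hs _ _ (hR w y u hwy h2 h3).2)
      have := hN w u hsw (by omega) this
      omega

theorem lemR [Finite V] {G : V → V → Prop} (hs : ∀ x y, G x y → G y x) {π σ τ : V → ℤ}
    (hπ : Function.Injective π) (hσ : Function.Injective σ)
    (hR : Rob G π) (hL : LB G σ) {s : V} (hP : Par G σ s) (hfirst : ∀ x, π s ≤ π x)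
    (htie : ∀ y z, σ y < σ z → (∀ u, σ u < σ y → (G u y ↔ G u z)) → τ z < τ y)
    (hτ : ∀ w y z, π y < π z → π z < π w → G w z → ¬ G w y → τ z < τ y)
    (w y z : V) (hyz : π y < π z) (hzw : π z < π w) (hG : G w z) (hG' : ¬ G w y) :
    σ y < σ z := by
  have hN := lemN hs hπ hσ hR hL hP
  have ht := hτ w y z hyz hzw hG hG'
  rcases lt_or σ hσ (x := y) (y := z) (by rintro rfl; omega) with h | h
  · exact h
  · have : ∃ u, σ u < σ z ∧ G u z ∧ ¬ G u y := by
      by_contra hno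
      push Not at hno
      have := htie z y h (by
        intro u hu
        refine ⟨hno u hu, fun huy => ?_⟩
        by_contra huz
        obtain ⟨v, hv, hvz, hvy⟩ := hL u z y hu h huy huz
        exact hvy (hno v (by omega) hvz))
      omega
    obtain ⟨u, hu, huz, huy⟩ := this
    rcases lt_or π hπ (x := u) (y := y) (by rintro rfl; omega) with h2 | h2
    · exact absurd (hR u y z h2 hyz huz).1 huy
    · have := hN y u (hfirst y) h2 (fun h => huy (hs _ _ h))
      omega

theorem lemFinal [Finite V] {G : V → V → Prop} (hs : ∀ x y, G x y → G y x) {π σ τ : V → ℤ}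
    (hπ : Function.Injective π) (hσ : Function.Injective σ)
    (hR : Rob G π) (hL : LB G σ) {s : V} (hP : Par G σ s) (hfirst : ∀ x, π s ≤ π x)
    (htie : ∀ y z, σ y < σ z → (∀ u, σ u < σ y → (G u y ↔ G u z)) → τ z < τ y)
    (hτ : ∀ w y z, π y < π z → π z < π w → G w z → ¬ G w y → τ z < τ y) : Rob G σ := by
  have hN := fun w u => lemN hs hπ hσ hR hL hP w u (hfirst w)
  have hLL := fun w y z => lemL hs hπ hσ hR hL hP w y z (hfirst w)
  have hRR := lemR hs hπ hσ hR hL hP hfirst htie hτ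
  intro x y z hxy hyz hxz
  have nxy : x ≠ y := by rintro rfl; omega
  have nyz : y ≠ z := by rintro rfl; omega
  have nxz : x ≠ z := by rintro rfl; omega
  constructor
  · by_contra hn
    have h1 : π x < π y := by
      rcases lt_or π hπ nxy with h | h
      · exact h
      · have := hN y x h (fun h => hn (hs _ _ h)); omega
    rcases lt_or π hπ nyz with h | h
    · exact hn (hR x y z h1 h hxz).1
    · rcases lt_or π hπ nxz with h2 | h2
      · have := hLL x z y h2 h hxz hn; omega
      · have := hN z y h (fun h3 => hn (hR z x y h2 h1 h3).2); omega
  · by_contra hn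
    have h1 : π y < π z := by
      rcases lt_or π hπ nyz with h | h
      · exact h
      · have := hN z y h (fun h => hn (hs _ _ h)); omega
    rcases lt_or π hπ nxy with h | h
    · exact hn (hR x y z h h1 hxz).2
    · rcases lt_or π hπ nxz with h2 | h2
      · have := hRR z y x h h2 (hs _ _ hxz) (fun h => hn (hs _ _ h)); omega
      · have := hN y x h (fun h3 => hn (hR y z x h1 h2 h3).1); omega

/-- The last vertex is a twin of the end vertex. -/
theorem lemTwin [Finite V] {G : V → V → Prop} (hs : ∀ x y, G x y → G y x) {π σ : V → ℤ}
    (hπ : Function.Injective π) (hσ : Function.Injective σ)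
    (hR : Rob G π) (hL : LB G σ) {s : V} (hP : Par G σ s) (hsf : ∀ x, σ s ≤ σ x)
    (b r : V) (hb : ∀ x, σ x ≤ σ b) (hsb : π s < π b) (hbr : π b < π r) (hr : ∀ x, π x ≤ π r) :
    G b r ∧ ∀ w, w ≠ b → w ≠ r → (G w b ↔ G w r) := by
  have hN := lemN hs hπ hσ hR hL hP
  have hLL := lemL hs hπ hσ hR hL hP
  have nbr : b ≠ r := by rintro rfl; omega
  have hbr' : G b r := by
    by_contra hn
    have := hN b r hsb.le hbr hn
    have := hb r
    omega
  refine ⟨hbr', fun w hwb hwr => ?_⟩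
  have hwr2 : π w < π r := lt_of_le_of_ne (hr w) (fun e => hwr (hπ e))
  rcases lt_or π hπ hwb with h | h
  swap
  · have := hR b w r h hwr2 hbr'
    exact ⟨fun _ => this.2, fun _ => hs _ _ this.1⟩
  refine ⟨fun hG => ?_, fun hG => (hR w b r h hbr hG).1⟩
  by_contra hG'
  have hws : π w < π s := by
    by_contra hc
    have := hLL w b r (by omega) h hbr hG hG'
    have := hb r
    omega
  have hwsb := hR w s b hws hsb hG
  have hsr : G s r := by
    by_contra hc
    have := hLL s b r le_rfl hsb hbr hwsb.2 hc
    have := hb r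
    omega
  have hrb : σ r < σ b := lt_of_le_of_ne (hb r) (fun e => nbr (hσ e).symm)
  have hwbσ : σ w < σ b := lt_of_le_of_ne (hb w) (fun e => hwb (hσ e))
  have hrw : σ r < σ w := by
    rcases lt_or σ hσ hwr with h2 | h2
    swap
    · exact h2
    obtain ⟨u, hu, hur, hub⟩ := hL w r b h2 hrb hG hG'
    rcases lt_or π hπ (x := u) (y := b) (by rintro rfl; omega) with h3 | h3
    · exact absurd (hR u b r h3 hbr hur).1 hub
    · have := lt_of_le_of_ne (hr u) (fun e => by
        have := hσ.eq_iff.2 (hπ e); omega)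
      exact absurd (hs _ _ (hR b u r h3 this hbr').1) hub
  -- descent
  obtain ⟨q, ⟨hbq, hwq, hGbq, hqw⟩, hmin⟩ := exists_first σ
    (fun q => π b < π q ∧ ¬ G w q ∧ G b q ∧ σ q < σ w) ⟨r, hbr, hG', hbr', hrw⟩
  obtain ⟨u, huq, huw, hub⟩ := hL q w b hqw hwbσ (hs _ _ hGbq) (fun h => hwq (hs _ _ h))
  have hub2 : π u < π b := by
    rcases lt_or π hπ (x := u) (y := b) (by rintro rfl; omega) with h3 | h3
    · exact h3
    · exact absurd (hs _ _ (hR w b u h h3 (hs _ _ huw)).2) hub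
  have huw2 : π u < π w := by
    rcases lt_or π hπ (x := u) (y := w) (by rintro rfl; omega) with h3 | h3
    · exact h3
    · exact absurd (hR w u b h3 hub2 hG).2 hub
  have hnuq : ¬ G u q := fun h3 => hwq (hR u w q huw2 (by omega) h3).2
  obtain ⟨v, hvu, hvq, hvw⟩ := hL u q w huq hqw huw hnuq
  have hvw2 : π w < π v := by
    rcases lt_or π hπ (x := v) (y := w) (by rintro rfl; omega) with h3 | h3
    · exact absurd (hR v w q h3 (by omega) hvq).1 hvw
    · exact h3
  have hbv : π b < π v := by
    rcases lt_or π hπ (x := v) (y := b) (by rintro rfl; have := hb q; omega) with h3 | h3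
    · exact absurd (hs _ _ (hR w v b hvw2 h3 hG).1) hvw
    · exact h3
  have hsv : G s v := by
    by_contra hc
    have hsv : σ s < σ v := lt_of_le_of_ne (hsf v) (fun e => by
      have := hσ e; subst this; omega)
    obtain ⟨t, ht, _⟩ := hL s v w hsv (by omega) (hs _ _ hwsb.1) hc
    have := hsf t
    omega
  have := hmin v ⟨hbv, fun h => hvw (hs _ _ h), (hR s b v hsb hbv hsv).2, by omega⟩
  omega

theorem lemEnd [Finite V] {G : V → V → Prop} (hs : ∀ x y, G x y → G y x)
    (hirr : ∀ x, ¬ G x x) {π σ : V → ℤ}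
    (hπ : Function.Injective π) (hσ : Function.Injective σ)
    (hR : Rob G π) (hL : LB G σ) {s : V} (hP : Par G σ s) (hsf : ∀ x, σ s ≤ σ x)
    (b : V) (hb : ∀ x, σ x ≤ σ b) (hsb : π s < π b) :
    ∃ π' : V → ℤ, Function.Injective π' ∧ Rob G π' ∧ (∀ x, π' x ≤ π' b) ∧
      π' s = π s ∧ ((∀ x, π s ≤ π x) → ∀ x, π' s ≤ π' x) := by
  classical
  obtain ⟨r, -, hr⟩ := exists_first (fun x => - π x) (fun _ : V => True) ⟨b, trivial⟩
  have hr : ∀ x, π x ≤ π r := fun x => by have := hr x trivial; omega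
  by_cases hbr : b = r
  · subst hbr
    exact ⟨π, hπ, hR, hr, rfl, id⟩
  have hbr2 : π b < π r := lt_of_le_of_ne (hr b) (fun e => hbr (hπ e))
  obtain ⟨h1, h2⟩ := lemTwin hs hπ hσ hR hL hP hsf b r hb hsb hbr2 hr
  have hsw : Equiv.swap b r s = s :=
    Equiv.swap_apply_of_ne_of_ne (by rintro rfl; omega) (by rintro rfl; omega)
  have haut : ∀ x y, G (Equiv.swap b r x) (Equiv.swap b r y) ↔ G x y := by
    intro x y
    simp only [Equiv.swap_apply_def]
    grind
  refine ⟨fun x => π (Equiv.swap b r x), hπ.comp (Equiv.injective _), ?_, ?_, ?_, ?_⟩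
  · intro x y z hxy hyz hxz
    have := hR _ _ _ hxy hyz ((haut _ _).2 hxz)
    simpa only [haut] using this
  · intro x; simpa using hr _
  · simp only [hsw]
  · intro h x; simp only [hsw]; exact h _

theorem mainAux [Finite V] {G : V → V → Prop} (hs : ∀ x y, G x y → G y x)
    (hirr : ∀ x, ¬ G x x) {π σ₀ σ₁ σ₂ : V → ℤ}
    (hπ : Function.Injective π) (hR : Rob G π)
    (hσ₀ : Function.Injective σ₀) (hσ₁ : Function.Injective σ₁) (hσ₂ : Function.Injective σ₂)
    (hL₀ : LB G σ₀) (hL₁ : LB G σ₁) (hL₂ : LB G σ₂)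
    (hP : ∀ σ : V → ℤ, Function.Injective σ → LB G σ → ∀ s, (∀ x, σ s ≤ σ x) → Par G σ s)
    (ht₁ : ∀ y z, σ₁ y < σ₁ z → (∀ u, σ₁ u < σ₁ y → (G u y ↔ G u z)) → σ₀ z < σ₀ y)
    (ht₂ : ∀ y z, σ₂ y < σ₂ z → (∀ u, σ₂ u < σ₂ y → (G u y ↔ G u z)) → σ₁ z < σ₁ y) :
    Rob G σ₂ := by
  rcases isEmpty_or_nonempty V with hE | ⟨⟨v0⟩⟩
  · intro x; exact hE.elim x
  have ex : ∀ σ : V → ℤ, ∃ s, ∀ x, σ s ≤ σ x := fun σ => by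
    obtain ⟨s, -, h⟩ := exists_first σ (fun _ : V => True) ⟨v0, trivial⟩
    exact ⟨s, fun x => h x trivial⟩
  obtain ⟨s, hsf⟩ := ex σ₀
  obtain ⟨a, ha⟩ := ex σ₁
  obtain ⟨b, hb⟩ := ex σ₂
  have hla : ∀ x, σ₀ x ≤ σ₀ a := by
    intro x
    by_contra hc
    have hne : a ≠ x := by rintro rfl; omega
    have := ht₁ a x (lt_of_le_of_ne (ha x) (fun e => hne (hσ₁ e)))
      (fun u hu => absurd (ha u) (by omega))
    omega
  have hlb : ∀ x, σ₁ x ≤ σ₁ b := by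
    intro x
    by_contra hc
    have hne : b ≠ x := by rintro rfl; omega
    have := ht₂ b x (lt_of_le_of_ne (hb x) (fun e => hne (hσ₂ e)))
      (fun u hu => absurd (hb u) (by omega))
    omega
  by_cases hsa : s = a
  · have hone : ∀ x, x = s := fun x => hσ₀ (le_antisymm (hsa ▸ hla x) (hsf x))
    intro x y z h
    rw [hone x, hone y] at h
    exact absurd h (lt_irrefl _)
  by_cases hab : a = b
  · have hone : ∀ x, x = a := fun x => hσ₁ (le_antisymm (hab ▸ hlb x) (ha x))
    intro x y z h
    rw [hone x, hone y] at h
    exact absurd h (lt_irrefl _)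
  have hneg : ∀ {f : V → ℤ}, Function.Injective f → Function.Injective (fun x => - f x) :=
    fun hf x y h => hf (by simpa using h)
  -- wlog s before a
  obtain ⟨π₀, hπ₀, hR₀, hs0⟩ : ∃ π₀ : V → ℤ, Function.Injective π₀ ∧ Rob G π₀ ∧ π₀ s < π₀ a := by
    rcases lt_or π hπ hsa with h | h
    · exact ⟨π, hπ, hR, h⟩
    · exact ⟨_, hneg hπ, hR.neg hs, by simpa using h⟩
  obtain ⟨π₁, hπ₁, hR₁, hl₁, -, -⟩ :=
    lemEnd hs hirr hπ₀ hσ₀ hR₀ hL₀ (hP _ hσ₀ hL₀ s hsf) hsf a hla hs0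
  have hf₁ : ∀ x, - π₁ a ≤ - π₁ x := fun x => by have := hl₁ x; omega
  have hP₁ := hP _ hσ₁ hL₁ a ha
  obtain ⟨π₂, hπ₂, hR₂, hl₂, -, hf₂⟩ :=
    lemEnd hs hirr (hneg hπ₁) hσ₁ (hR₁.neg hs) hL₁ hP₁ ha b hlb
      (lt_of_le_of_ne (hf₁ b) (fun e => hab (hneg hπ₁ e)))
  have hf₂ := hf₂ hf₁
  refine lemFinal hs (hneg hπ₂) hσ₂ (hR₂.neg hs) hL₂ (hP _ hσ₂ hL₂ b hb)
    (fun x => by have := hl₂ x; omega) ht₂ ?_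
  intro w y z hyz hzw hG hG'
  exact lemL hs hπ₂ hσ₁ hR₂ hL₁ hP₁ w z y (hf₂ w) (by omega) (by omega) hG hG'

end SFSProof

theorem stmt_18 {n : ℕ} (A : Matrix (Fin n) (Fin n) ℝ) (hA : A.IsSymm)
    (h01 : ∀ x y : Fin n, A x y = 0 ∨ A x y = 1) (hdiag : ∀ x : Fin n, A x x = 0)
    (hconn : (SimpleGraph.fromRel (fun x y : Fin n => A x y = 1)).Connected)
    (σ₀ σ₁ σ₂ : Equiv.Perm (Fin n))
    (h0 : IsSFSOrdering A σ₀) (h1 : IsSFSPlus A σ₀ σ₁) (h2 : IsSFSPlus A σ₁ σ₂) :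
    IsRobinsonian A ↔ IsRobinsonOrdering A σ₂ := by
  refine ⟨fun ⟨π, hπ⟩ => ?_, fun h => ⟨σ₂, h⟩⟩
  let G : Fin n → Fin n → Prop := fun x y => A x y = 1
  let c : Equiv.Perm (Fin n) → Fin n → ℤ := fun σ x => ((σ x : ℕ) : ℤ)
  have hc : ∀ σ x y, c σ x < c σ y ↔ σ x < σ y := fun σ x y => by
    simp only [c, Nat.cast_lt, Fin.lt_def]
  have hinj : ∀ σ, Function.Injective (c σ) := fun σ x y h => by
    simp only [c, Nat.cast_inj] at h
    exact σ.injective (Fin.ext h)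
  have hlt : ∀ x y x' y', A x y < A x' y' ↔ (A x y ≠ 1 ∧ A x' y' = 1) := by
    intro x y x' y'
    rcases h01 x y with h | h <;> rcases h01 x' y' with h' | h' <;> rw [h, h'] <;> norm_num
  have heq : ∀ x y x' y', A x y = A x' y' ↔ (A x y = 1 ↔ A x' y' = 1) := by
    intro x y x' y'
    rcases h01 x y with h | h <;> rcases h01 x' y' with h' | h' <;> rw [h, h'] <;> norm_num
  have hs : ∀ x y, G x y → G y x := fun x y h => by
    simp only [G] at *
    rw [← h]; exact hA.apply _ _
  have hirr : ∀ x, ¬ G x x := fun x h => by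
    simp only [G, hdiag] at h; norm_num at h
  have hrob : ∀ σ, IsRobinsonOrdering A σ ↔ SFSProof.Rob G (c σ) := by
    intro σ
    refine forall_congr' fun x => forall_congr' fun y => forall_congr' fun z => ?_
    rw [hc, hc, le_min_iff, ← not_lt, ← not_lt, hlt, hlt]
    simp only [G]
    tauto
  have hLB : ∀ σ, IsSFSOrdering A σ → SFSProof.LB G (c σ) := by
    intro σ h x y z hxy hyz hxz hxy'
    obtain ⟨u, hu, hu'⟩ := h x y z ((hc _ _ _).1 hxy) ((hc _ _ _).1 hyz) ((hlt _ _ _ _).2 ⟨hxy', hxz⟩)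
    rw [hlt] at hu'
    exact ⟨u, (hc _ _ _).2 hu, hu'.2, hu'.1⟩
  have htie : ∀ τ σ, IsSFSPlus A τ σ → ∀ y z, c σ y < c σ z →
      (∀ u, c σ u < c σ y → (G u y ↔ G u z)) → c τ z < c τ y := by
    intro τ σ h y z hyz hu
    exact (hc _ _ _).2 (h.2 y z ((hc _ _ _).1 hyz)
      (fun u hu' => (heq _ _ _ _).2 (hu u ((hc _ _ _).2 hu'))))
  have hPar : ∀ σ : Fin n → ℤ, Function.Injective σ → SFSProof.LB G σ → ∀ s, (∀ x, σ s ≤ σ x) →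
      SFSProof.Par G σ s := by
    intro σ hσ hL s hsf v hvs
    by_contra hno
    push Not at hno
    have hsv : σ s < σ v := lt_of_le_of_ne (hsf v) (fun e => hvs (hσ e).symm)
    have : ∀ y, Relation.ReflTransGen
        (SimpleGraph.fromRel (fun x y : Fin n => A x y = 1)).Adj s y → σ y < σ v := by
      intro y hy
      induction hy with
      | refl => exact hsv
      | tail hprev hadj ih =>
        rename_i x y
        have hxy : G x y := by
          rw [SimpleGraph.fromRel_adj] at hadj
          rcases hadj.2 with h | h
          · exact h
          · exact hs _ _ h
        have hyv : y ≠ v := by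
          rintro rfl; exact hno x ih hxy
        rcases SFSProof.lt_or σ hσ hyv with h | h
        · exact h
        · obtain ⟨u, hu, huv, _⟩ := hL x v y ih h hxy (hno x ih)
          exact absurd huv (hno u (by omega))
    have := this v ((SimpleGraph.reachable_iff_reflTransGen _ _).1 (hconn.preconnected s v))
    omega
  rw [hrob] at hπ ⊢
  exact SFSProof.mainAux hs hirr (hinj _) hπ (hinj _) (hinj _) (hinj _)
    (hLB _ h0) (hLB _ h1.1) (hLB _ h2.1) hPar (htie _ _ h1) (htie _ _ h2)
end
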